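/- For every edge y of ℤ² and every k ≥ 1, sup over n of ℙ(|(v_n)_y| > 2^{2k}) ≤ 2·2^{−k}. Consequently sup_n ℙ(|(v_n)_y| > C) = O(1/√C) as C → ∞. -/

import Mathlib

/-- Translation of the plane `ℤ²`. -/
def trP (t p : ℤ × ℤ) : ℤ × ℤ := (p.1 + t.1, p.2 + t.2)

/-- Vertical reflection inside a block of height `m` (`y ↦ m - 1 - y`):
used to turn two of the four copies upside down. -/
def reflP (m : ℤ) (p : ℤ × ℤ) : ℤ × ℤ := (p.1, m - 1 - p.2)

/-- The edge set of the `n`-th fragment, a subgraph of the grid `ℤ²` living on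
the square `[0, 2^n-2] × [0, 2^n-2]`.  The first fragment is a single vertex
with no edges; the `(n+1)`-th fragment consists of four copies of the `n`-th
fragment placed in the four quadrants (the two top ones turned upside down),
joined to the full central row and column by one connecting edge per copy. -/
def fragEdges : ℕ → Set (Sym2 (ℤ × ℤ))
  | 0 => ∅
  | 1 => ∅
  | (n + 2) =>
      let m : ℤ := 2 ^ (n + 1) - 1
      (Sym2.map (trP (0, 0)) '' fragEdges (n + 1)) ∪
      (Sym2.map (trP (m + 1, 0)) '' fragEdges (n + 1)) ∪
      (Sym2.map (fun p => trP (0, m + 1) (reflP m p)) '' fragEdges (n + 1)) ∪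
      (Sym2.map (fun p => trP (m + 1, m + 1) (reflP m p)) '' fragEdges (n + 1)) ∪
      {e | ∃ x : ℤ, 0 ≤ x ∧ x < 2 * m ∧ e = s((x, m), (x + 1, m))} ∪
      {e | ∃ y : ℤ, 0 ≤ y ∧ y < 2 * m ∧ e = s((m, y), (m, y + 1))} ∪
      {s((m - 1, m - 1), (m - 1, m)), s((m + 1, m - 1), (m + 1, m)),
       s((m - 1, m + 1), (m - 1, m)), s((m + 1, m + 1), (m + 1, m))}

/-- The vertex set of the `n`-th fragment: the `(2^n-1) × (2^n-1)` grid square. -/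
def fragVerts (n : ℕ) : Set (ℤ × ℤ) :=
  {p | 0 ≤ p.1 ∧ p.1 < 2 ^ n - 1 ∧ 0 ≤ p.2 ∧ p.2 < 2 ^ n - 1}

/-- The second endpoint of the edge based at `p` in direction `b`
(`true` = rightward/horizontal, `false` = upward/vertical). -/
def ept (p : ℤ × ℤ) (b : Bool) : ℤ × ℤ :=
  if b then (p.1 + 1, p.2) else (p.1, p.2 + 1)

/-- The divergence at a vertex `p` of an (integer) vector field `u` on `ℤ²`,
where `u q b` is the value on the oriented edge going out of `q` rightward
(`b = true`) or upward (`b = false`): the sum of the field over the four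
edges oriented out of `p`. -/
def divB (u : ℤ × ℤ → Bool → ℤ) (p : ℤ × ℤ) : ℤ :=
  u p true + u p false - u (p.1 - 1, p.2) true - u (p.1, p.2 - 1) false

open MeasureTheory

/-- Shift (translate) a vector field on `ℤ²` by `t`; `w p b` is the value on the
edge going out of `p` rightward (`b = true`) or upward (`b = false`). -/
def shiftF (t : ℤ × ℤ) (w : ℤ × ℤ → Bool → ℤ) : ℤ × ℤ → Bool → ℤ :=
  fun p b => w (p.1 + t.1, p.2 + t.2) b

/-- The uniform probability measure on `Fin M × Fin M`
(the group of shifts of a doubly `M`-periodic configuration). -/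
noncomputable def unifShift (M : ℕ) : Measure (Fin M × Fin M) :=
  (Fintype.card (Fin M × Fin M) : ENNReal)⁻¹ • Measure.count

/-- Periodic extension (tiling) of a vector field with period `m` in both
coordinates: the value on an edge is read off from the fundamental cell
`[0, m-1] × [0, m-1]` (edges between different cells get the value `0` of the
fragment field there). -/
def tiled (m : ℤ) (u : ℤ × ℤ → Bool → ℤ) : ℤ × ℤ → Bool → ℤ :=
  fun p b => u (p.1 % m, p.2 % m) b

namespace Frag

/-- horizontal displacement of a direction -/
def dx (b : Bool) : ℤ := if b then 1 else 0
/-- vertical displacement of a direction -/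
def dy (b : Bool) : ℤ := if b then 0 else 1

/-- cross and connecting edges (centred coordinates) -/
def C (a : ℤ) (b : Bool) (x y : ℤ) : Prop :=
  if b then y = 0 ∧ -(2 * a - 1) ≤ x ∧ x < 2 * a - 1
  else (x = 0 ∧ -(2 * a - 1) ≤ y ∧ y < 2 * a - 1) ∨ ((x = 1 ∨ x = -1) ∧ (y = 0 ∨ y = -1))

/-- the outer side of a cross or connecting edge -/
def X (b : Bool) (x y p q : ℤ) : Prop :=
  if b then (x = 0 ∧ 1 ≤ p) ∨ (x = -1 ∧ p ≤ -1) ∨ (0 < x ∧ q = 0 ∧ x + 1 ≤ p) ∨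
    (x < -1 ∧ q = 0 ∧ p ≤ x)
  else (x = 0 ∧ p = 0 ∧ ((0 ≤ y ∧ y + 1 ≤ q) ∨ (y ≤ -1 ∧ q ≤ y))) ∨
    (((x = 1 ∧ 1 ≤ p) ∨ (x = -1 ∧ p ≤ -1)) ∧ ((y = 0 ∧ 1 ≤ q) ∨ (y = -1 ∧ q ≤ -1)))

/-- edges of the fragment of level `j + 1`, centred at the origin -/
def G : ℕ → Bool → ℤ → ℤ → Prop
  | 0, _, _, _ => False
  | j + 1, b, x, y =>
    (∃ s t : ℤ, (s = 1 ∨ s = -1) ∧ (t = 1 ∨ t = -1) ∧ G j b (x - s * 2 ^ j) (y - t * 2 ^ j)) ∨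
    C (2 ^ j) b x y

/-- the side of an edge that does not contain the centre -/
def W : ℕ → Bool → ℤ → ℤ → ℤ → ℤ → Prop
  | 0, _, _, _, _, _ => False
  | j + 1, b, x, y, p, q =>
    (C (2 ^ j) b x y ∧ X b x y p q) ∨
    (∃ s t : ℤ, (s = 1 ∨ s = -1) ∧ (t = 1 ∨ t = -1) ∧ G j b (x - s * 2 ^ j) (y - t * 2 ^ j) ∧
      1 ≤ s * p ∧ 1 ≤ t * q ∧
      ¬ (W j b (x - s * 2 ^ j) (y - t * 2 ^ j) (p - s * 2 ^ j) (q - t * 2 ^ j) ↔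
         W j b (x - s * 2 ^ j) (y - t * 2 ^ j) (-s * (2 ^ j - 1)) (-t * (2 ^ j - 1))))

lemma G_sq (j : ℕ) : ∀ (b : Bool) (x y : ℤ), G j b x y →
    -(2 ^ j - 1) ≤ x ∧ x + dx b ≤ 2 ^ j - 1 ∧ -(2 ^ j - 1) ≤ y ∧ y + dy b ≤ 2 ^ j - 1 := by
  induction j with
  | zero => intro b x y h; exact h.elim
  | succ j ih =>
    intro b x y h
    have ha : (1 : ℤ) ≤ 2 ^ j := one_le_pow₀ (by norm_num)
    rw [pow_succ]
    rcases h with ⟨s, t, hs, ht, h⟩ | h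
    · have := ih _ _ _ h
      generalize (2 : ℤ) ^ j = a at *
      rcases hs with rfl | rfl <;> rcases ht with rfl | rfl <;> cases b <;>
        simp only [dx, dy, if_true, Bool.false_eq_true, if_false] at * <;> omega
    · generalize (2 : ℤ) ^ j = a at *
      cases b <;> simp only [C, dx, dy, if_true, Bool.false_eq_true, if_false] at * <;> omega

lemma G_refl (j : ℕ) : ∀ (b : Bool) (x y : ℤ), G j b x y → G j b x (-y - dy b) := by
  induction j with
  | zero => intro b x y h; exact h.elim
  | succ j ih =>
    intro b x y h
    rcases h with ⟨s, t, hs, ht, h⟩ | h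
    · refine Or.inl ⟨s, -t, hs, by omega, ?_⟩
      have := ih _ _ _ h
      convert this using 1
      ring
    · refine Or.inr ?_
      generalize (2 : ℤ) ^ j = a at *
      cases b <;> simp only [C, dx, dy, if_true, Bool.false_eq_true, if_false] at * <;> omega

/-- quadrant edges are not cross edges -/
lemma not_C {j : ℕ} {b : Bool} {x y s t : ℤ} (hs : s = 1 ∨ s = -1) (ht : t = 1 ∨ t = -1)
    (h : G j b (x - s * 2 ^ j) (y - t * 2 ^ j)) : ¬ C (2 ^ j) b x y := by
  have := G_sq _ _ _ _ h
  generalize (2 : ℤ) ^ j = a at *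
  intro hC
  rcases hs with rfl | rfl <;> rcases ht with rfl | rfl <;> cases b <;>
        simp only [C, dx, dy, if_true, Bool.false_eq_true, if_false] at * <;> omega

lemma quad_sign {j : ℕ} {b : Bool} {x y s t : ℤ} (hs : s = 1 ∨ s = -1) (ht : t = 1 ∨ t = -1)
    (h : G j b (x - s * 2 ^ j) (y - t * 2 ^ j)) :
    1 ≤ s * x ∧ 1 ≤ t * y ∧ 1 ≤ s * (x + dx b) ∧ 1 ≤ t * (y + dy b) := by
  have := G_sq _ _ _ _ h
  generalize (2 : ℤ) ^ j = a at *
  rcases hs with rfl | rfl <;> rcases ht with rfl | rfl <;> cases b <;>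
        simp only [dx, dy, if_true, Bool.false_eq_true, if_false] at * <;> omega

lemma sign_unique {s s' x : ℤ} (hs : s = 1 ∨ s = -1) (hs' : s' = 1 ∨ s' = -1)
    (h : 1 ≤ s * x) (h' : 1 ≤ s' * x) : s' = s := by
  rcases hs with rfl | rfl <;> rcases hs' with rfl | rfl <;> omega

lemma W_cross {j : ℕ} {b : Bool} {x y : ℤ} (h : C (2 ^ j) b x y) (p q : ℤ) :
    W (j + 1) b x y p q ↔ X b x y p q := by
  constructor
  · rintro (⟨_, h'⟩ | ⟨s, t, hs, ht, h', _⟩)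
    · exact h'
    · exact (not_C hs ht h' h).elim
  · intro h'; exact Or.inl ⟨h, h'⟩

lemma W_quad {j : ℕ} {b : Bool} {x y s t : ℤ} (hs : s = 1 ∨ s = -1) (ht : t = 1 ∨ t = -1)
    (h : G j b (x - s * 2 ^ j) (y - t * 2 ^ j)) (p q : ℤ) :
    W (j + 1) b x y p q ↔ (1 ≤ s * p ∧ 1 ≤ t * q ∧
      ¬ (W j b (x - s * 2 ^ j) (y - t * 2 ^ j) (p - s * 2 ^ j) (q - t * 2 ^ j) ↔
         W j b (x - s * 2 ^ j) (y - t * 2 ^ j) (-s * (2 ^ j - 1)) (-t * (2 ^ j - 1)))) := by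
  constructor
  · rintro (⟨h', _⟩ | ⟨s', t', hs', ht', h', h''⟩)
    · exact (not_C hs ht h h').elim
    · have e1 := quad_sign hs ht h
      have e2 := quad_sign hs' ht' h'
      obtain rfl := sign_unique hs hs' e1.1 e2.1
      obtain rfl := sign_unique ht ht' e1.2.1 e2.2.1
      exact h''
  · intro h'; exact Or.inr ⟨s, t, hs, ht, h, h'⟩

lemma xor_aux (P Q R : Prop) : ((¬ (P ↔ R)) ↔ ¬ (Q ↔ R)) ↔ (P ↔ Q) := by
  by_cases hP : P <;> by_cases hQ : Q <;> by_cases hR : R <;> simp [hP, hQ, hR]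

set_option maxHeartbeats 1000000 in
lemma cut (j : ℕ) : ∀ (b : Bool) (x y : ℤ), G j b x y → ∀ (b' : Bool) (x' y' : ℤ), G j b' x' y' →
    ((W j b x y x' y' ↔ W j b x y (x' + dx b') (y' + dy b')) ↔ ¬ (b' = b ∧ x' = x ∧ y' = y)) := by
  induction j with
  | zero => intro b x y h; exact h.elim
  | succ j ih =>
    intro b x y h b' x' y' h'
    have ha : (1 : ℤ) ≤ 2 ^ j := one_le_pow₀ (by norm_num)
    rcases h with ⟨s, t, hs, ht, h⟩ | h
    · rw [W_quad hs ht h, W_quad hs ht h]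
      have e1 := quad_sign hs ht h
      rcases h' with ⟨s', t', hs', ht', h'⟩ | h'
      · have e2 := quad_sign hs' ht' h'
        by_cases hst : s' = s ∧ t' = t
        · obtain ⟨rfl, rfl⟩ := hst
          have := ih _ _ _ h _ _ _ h'
          rw [show x' - s' * 2 ^ j + dx b' = x' + dx b' - s' * 2 ^ j by ring,
            show y' - t' * 2 ^ j + dy b' = y' + dy b' - t' * 2 ^ j by ring,
            sub_left_inj, sub_left_inj] at this
          rw [← this]
          simp only [e2, true_and]
          exact xor_aux _ _ _
        · have n1 : ∀ p q, 1 ≤ s' * p → 1 ≤ t' * q → ¬ (1 ≤ s * p ∧ 1 ≤ t * q) := by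
            intro p q h1 h2 h3
            exact hst ⟨sign_unique hs hs' h3.1 h1, sign_unique ht ht' h3.2 h2⟩
          have n2 := n1 _ _ e2.1 e2.2.1
          have n3 := n1 _ _ e2.2.2.1 e2.2.2.2
          have n4 : ¬ (b' = b ∧ x' = x ∧ y' = y) := by
            rintro ⟨rfl, rfl, rfl⟩; exact n2 ⟨e1.1, e1.2.1⟩
          exact iff_of_true (iff_of_false (fun h => n2 ⟨h.1, h.2.1⟩)
            (fun h => n3 ⟨h.1, h.2.1⟩)) n4
      · have n4 : ¬ (b' = b ∧ x' = x ∧ y' = y) := by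
          rintro ⟨rfl, rfl, rfl⟩; exact not_C hs ht h h'
        simp only [n4, not_false_eq_true, iff_true]
        -- either an endpoint is not in the quadrant, or it is the corner
        have key : ∀ p q, (p = x' ∧ q = y') ∨ (p = x' + dx b' ∧ q = y' + dy b') →
            ¬ (1 ≤ s * p ∧ 1 ≤ t * q) ∨
            (p - s * 2 ^ j = -s * (2 ^ j - 1) ∧ q - t * 2 ^ j = -t * (2 ^ j - 1)) := by
          intro p q hpq
          generalize (2 : ℤ) ^ j = a at *
          rcases hs with rfl | rfl <;> rcases ht with rfl | rfl <;> cases b' <;>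
            simp only [C, dx, dy, if_true, Bool.false_eq_true, if_false] at h' hpq <;> omega
        have k1 := key _ _ (Or.inl ⟨rfl, rfl⟩)
        have k2 := key _ _ (Or.inr ⟨rfl, rfl⟩)
        have gen : ∀ p q, (¬ (1 ≤ s * p ∧ 1 ≤ t * q) ∨
            (p - s * 2 ^ j = -s * (2 ^ j - 1) ∧ q - t * 2 ^ j = -t * (2 ^ j - 1))) →
            ¬ (1 ≤ s * p ∧ 1 ≤ t * q ∧
      ¬ (W j b (x - s * 2 ^ j) (y - t * 2 ^ j) (p - s * 2 ^ j) (q - t * 2 ^ j) ↔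
         W j b (x - s * 2 ^ j) (y - t * 2 ^ j) (-s * (2 ^ j - 1)) (-t * (2 ^ j - 1)))) := by
          rintro p q (h1 | ⟨h1, h2⟩)
          · exact fun h => h1 ⟨h.1, h.2.1⟩
          · rw [h1, h2]; exact fun h => h.2.2 Iff.rfl
        exact iff_of_false (gen _ _ k1) (gen _ _ k2)
    · rw [W_cross h, W_cross h]
      rcases h' with ⟨s', t', hs', ht', h'⟩ | h'
      · have n4 : ¬ (b' = b ∧ x' = x ∧ y' = y) := by
          rintro ⟨rfl, rfl, rfl⟩; exact not_C hs' ht' h' h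
        simp only [n4, not_false_eq_true, iff_true]
        have e2 := quad_sign hs' ht' h'
        clear h' n4
        generalize (2 : ℤ) ^ j = a at *
        rcases hs' with rfl | rfl <;> rcases ht' with rfl | rfl <;> cases b' <;> cases b <;>
            simp only [C, X, dx, dy, if_true, Bool.false_eq_true, if_false] at h e2 ⊢ <;> omega
      · generalize (2 : ℤ) ^ j = a at *
        cases b' <;> cases b <;>
            simp only [C, X, dx, dy, if_true, Bool.false_eq_true, if_false, true_and, false_and,
              not_false_eq_true, iff_true, reduceCtorEq] at h h' ⊢ <;> omega

lemma G_of_frag (j : ℕ) : ∀ e ∈ fragEdges (j + 1), ∃ b x y, G j b x y ∧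
    e = s((x + (2 ^ j - 1), y + (2 ^ j - 1)), (x + dx b + (2 ^ j - 1), y + dy b + (2 ^ j - 1))) := by
  induction j with
  | zero => intro e he; exact he.elim
  | succ j ih =>
    intro e he
    have quad : ∀ s t : ℤ, (s = 1 ∨ s = -1) → (t = 1 ∨ t = -1) → ∀ b x y, G j b x y →
        G (j + 1) b (x + s * 2 ^ j) (y + t * 2 ^ j) := by
      intro s t hs ht b x y h
      exact Or.inl ⟨s, t, hs, ht, by simpa using h⟩
    have cross : ∀ b x y, C (2 ^ j) b x y → G (j + 1) b x y := fun b x y h => Or.inr h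
    simp only [fragEdges, Set.mem_union, Set.mem_image, Set.mem_ofPred_eq,
      Set.mem_insert_iff, Set.mem_singleton_iff] at he
    rcases he with (((((⟨f, hf, rfl⟩ | ⟨f, hf, rfl⟩) | ⟨f, hf, rfl⟩) | ⟨f, hf, rfl⟩) | ⟨x, h0, h1, rfl⟩)
      | ⟨y, h0, h1, rfl⟩) | he
    · obtain ⟨b, x, y, hG, rfl⟩ := ih f hf
      refine ⟨b, _, _, quad (-1) (-1) (by simp) (by simp) b x y hG, ?_⟩
      simp only [Sym2.map_mk, trP, Sym2.eq_iff, Prod.mk.injEq]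
      left; rw [pow_succ]; refine ⟨⟨?_, ?_⟩, ?_, ?_⟩ <;> ring
    · obtain ⟨b, x, y, hG, rfl⟩ := ih f hf
      refine ⟨b, _, _, quad (1) (-1) (by simp) (by simp) b x y hG, ?_⟩
      simp only [Sym2.map_mk, trP, Sym2.eq_iff, Prod.mk.injEq]
      left; rw [pow_succ]; refine ⟨⟨?_, ?_⟩, ?_, ?_⟩ <;> ring
    · obtain ⟨b, x, y, hG, rfl⟩ := ih f hf
      refine ⟨b, _, _, quad (-1) (1) (by simp) (by simp) b _ _ (G_refl _ _ _ _ hG), ?_⟩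
      simp only [Sym2.map_mk, trP, reflP, Sym2.eq_iff, Prod.mk.injEq]
      rw [pow_succ]
      cases b <;> simp only [dx, dy, if_true, Bool.false_eq_true, if_false]
      · right; refine ⟨⟨?_, ?_⟩, ?_, ?_⟩ <;> ring
      · left; refine ⟨⟨?_, ?_⟩, ?_, ?_⟩ <;> ring
    · obtain ⟨b, x, y, hG, rfl⟩ := ih f hf
      refine ⟨b, _, _, quad (1) (1) (by simp) (by simp) b _ _ (G_refl _ _ _ _ hG), ?_⟩
      simp only [Sym2.map_mk, trP, reflP, Sym2.eq_iff, Prod.mk.injEq]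
      rw [pow_succ]
      cases b <;> simp only [dx, dy, if_true, Bool.false_eq_true, if_false]
      · right; refine ⟨⟨?_, ?_⟩, ?_, ?_⟩ <;> ring
      · left; refine ⟨⟨?_, ?_⟩, ?_, ?_⟩ <;> ring
    · refine ⟨true, x - (2 ^ (j + 1) - 1), 0, cross _ _ _ ?_, ?_⟩
      · have e : (2 : ℤ) ^ (j + 1) = 2 * 2 ^ j := by ring
        rw [e] at h1 ⊢
        generalize (2 : ℤ) ^ j = a at *
        simp only [C, if_true]
        exact ⟨trivial, by linarith, by linarith⟩
      · simp only [dx, dy, if_true, Sym2.eq_iff, Prod.mk.injEq]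
        left; refine ⟨⟨?_, ?_⟩, ?_, ?_⟩ <;> ring
    · refine ⟨false, 0, y - (2 ^ (j + 1) - 1), cross _ _ _ ?_, ?_⟩
      · have e : (2 : ℤ) ^ (j + 1) = 2 * 2 ^ j := by ring
        rw [e] at h1 ⊢
        generalize (2 : ℤ) ^ j = a at *
        simp only [C, Bool.false_eq_true, if_false]
        exact Or.inl ⟨trivial, by linarith, by linarith⟩
      · simp only [dx, dy, Bool.false_eq_true, if_false, Sym2.eq_iff, Prod.mk.injEq]
        left; refine ⟨⟨?_, ?_⟩, ?_, ?_⟩ <;> ring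
    · rcases he with rfl | rfl | rfl | rfl
      · refine ⟨false, -1, -1, cross _ _ _ (by simp [C]), ?_⟩
        simp only [dx, dy, Bool.false_eq_true, if_false, Sym2.eq_iff, Prod.mk.injEq]
        left; refine ⟨⟨?_, ?_⟩, ?_, ?_⟩ <;> ring
      · refine ⟨false, 1, -1, cross _ _ _ (by simp [C]), ?_⟩
        simp only [dx, dy, Bool.false_eq_true, if_false, Sym2.eq_iff, Prod.mk.injEq]
        left; refine ⟨⟨?_, ?_⟩, ?_, ?_⟩ <;> ring
      · refine ⟨false, -1, 0, cross _ _ _ (by simp [C]), ?_⟩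
        simp only [dx, dy, Bool.false_eq_true, if_false, Sym2.eq_iff, Prod.mk.injEq]
        right; refine ⟨⟨?_, ?_⟩, ?_, ?_⟩ <;> ring
      · refine ⟨false, 1, 0, cross _ _ _ (by simp [C]), ?_⟩
        simp only [dx, dy, Bool.false_eq_true, if_false, Sym2.eq_iff, Prod.mk.injEq]
        right; refine ⟨⟨?_, ?_⟩, ?_, ?_⟩ <;> ring

/-- decoding: a grid edge lying in the fragment is an edge of `G` in centred coordinates. -/
lemma G_of_frag' (j : ℕ) (b : Bool) (x y : ℤ)
    (h : s((x + (2 ^ j - 1), y + (2 ^ j - 1)), ept (x + (2 ^ j - 1), y + (2 ^ j - 1)) b)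
      ∈ fragEdges (j + 1)) : G j b x y := by
  obtain ⟨b', x', y', hG, he⟩ := G_of_frag j _ h
  generalize (2 : ℤ) ^ j = a at *
  have : b' = b ∧ x' = x ∧ y' = y := by
    cases b' <;> cases b <;>
    simp only [ept, dx, dy, if_true, Bool.false_eq_true, if_false, Sym2.eq_iff, Prod.mk.injEq,
      true_and, false_and, reduceCtorEq] at he ⊢ <;> omega
  obtain ⟨rfl, rfl, rfl⟩ := this
  exact hG

/-- the square of half-side `2^j - 1` centred at the origin -/
noncomputable def sq (j : ℕ) : Finset (ℤ × ℤ) :=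
  Finset.Icc (-(2 ^ j - 1)) (2 ^ j - 1) ×ˢ Finset.Icc (-(2 ^ j - 1)) (2 ^ j - 1)

lemma mem_sq {j : ℕ} {p : ℤ × ℤ} : p ∈ sq j ↔
    -(2 ^ j - 1) ≤ p.1 ∧ p.1 ≤ 2 ^ j - 1 ∧ -(2 ^ j - 1) ≤ p.2 ∧ p.2 ≤ 2 ^ j - 1 := by
  simp only [sq, Finset.mem_product, Finset.mem_Icc]; tauto

lemma G_mem_sq {j : ℕ} {b : Bool} {x y : ℤ} (h : G j b x y) :
    (x, y) ∈ sq j ∧ (x + dx b, y + dy b) ∈ sq j := by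
  have := G_sq _ _ _ _ h
  rw [mem_sq, mem_sq]
  generalize (2 : ℤ) ^ j = a at *
  cases b <;> simp only [dx, dy, if_true, Bool.false_eq_true, if_false] at * <;> omega

lemma card_sq (j : ℕ) : ((sq j).card : ℤ) = (2 * 2 ^ j - 1) ^ 2 := by
  have ha : (1 : ℤ) ≤ 2 ^ j := one_le_pow₀ (by norm_num)
  simp only [sq, Finset.card_product, Int.card_Icc]
  push_cast
  rw [Int.toNat_of_nonneg (by linarith)]
  ring

/-- translation -/
def sh (c d : ℤ) (p : ℤ × ℤ) : ℤ × ℤ := (p.1 + c, p.2 + d)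

open scoped Classical in
/-- edges whose outer side contains `(p, q)` -/
noncomputable def dep (j : ℕ) (b : Bool) (p q : ℤ) : Finset (ℤ × ℤ) :=
  (sq j).filter (fun e => G j b e.1 e.2 ∧ W j b e.1 e.2 p q)

lemma mem_dep {j : ℕ} {b : Bool} {p q : ℤ} {e : ℤ × ℤ} :
    e ∈ dep j b p q ↔ G j b e.1 e.2 ∧ W j b e.1 e.2 p q := by
  classical
  simp only [dep, Finset.mem_filter, and_iff_right_iff_imp]
  intro h
  exact (G_mem_sq h.1).1

lemma dep_axis (j : ℕ) (b : Bool) (p q : ℤ) (h : p = 0 ∨ q = 0) :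
    ((dep (j + 1) b p q).card : ℤ) ≤ 2 * 2 ^ j - 1 := by
  classical
  have ha : (1 : ℤ) ≤ 2 ^ j := one_le_pow₀ (by norm_num)
  let I : Finset ℤ := if 0 < (if b then p else q) then Finset.Icc 0 (2 * 2 ^ j - 2)
    else Finset.Icc (-(2 * 2 ^ j - 1)) (-1)
  have hI : (I.card : ℤ) = 2 * 2 ^ j - 1 := by
    simp only [I]
    split_ifs <;> rw [Int.card_Icc, Int.toNat_of_nonneg (by linarith)] <;> ring
  let R : Finset (ℤ × ℤ) := if b then I ×ˢ {0} else {0} ×ˢ I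
  have hR : (R.card : ℤ) = 2 * 2 ^ j - 1 := by
    rw [← hI]; simp only [R]; split_ifs <;> simp
  rw [← hR, Nat.cast_le]
  apply Finset.card_le_card
  rintro ⟨x, y⟩ he
  rw [mem_dep] at he
  obtain ⟨hG, hW⟩ := he
  simp only at hG hW
  rcases hG with ⟨s, t, hs, ht, hG⟩ | hG
  · rw [W_quad hs ht hG] at hW
    rcases h with rfl | rfl <;> simp at hW
  · rw [W_cross hG] at hW
    simp only [R, I]
    generalize (2 : ℤ) ^ j = a at *
    cases b <;> simp only [C, X, if_true, Bool.false_eq_true, if_false] at hG hW ⊢ <;>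
      split_ifs <;> simp only [Finset.mem_product, Finset.mem_singleton, Finset.mem_Icc] <;> omega

lemma dep_card (j : ℕ) : ∀ (b : Bool) (p q : ℤ), ((dep j b p q).card : ℤ) ≤ 2 ^ j - 1 := by
  classical
  induction j with
  | zero =>
    intro b p q
    have : dep 0 b p q = ∅ := by
      ext e; rw [mem_dep]; simp [G]
    simp [this]
  | succ j ih =>
    intro b p q
    by_cases h : p = 0 ∨ q = 0
    · have := dep_axis j b p q h
      rw [pow_succ]; linarith
    · push Not at h
      obtain ⟨s, hs, hsp⟩ : ∃ s : ℤ, (s = 1 ∨ s = -1) ∧ 1 ≤ s * p := by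
        rcases lt_or_gt_of_ne h.1 with h' | h'
        · exact ⟨-1, by simp, by omega⟩
        · exact ⟨1, by simp, by omega⟩
      obtain ⟨t, ht, htq⟩ : ∃ s : ℤ, (s = 1 ∨ s = -1) ∧ 1 ≤ s * q := by
        rcases lt_or_gt_of_ne h.2 with h' | h'
        · exact ⟨-1, by simp, by omega⟩
        · exact ⟨1, by simp, by omega⟩
      let R : ℤ × ℤ := if b then (if 1 ≤ p then 0 else -1, 0) else (s, if 1 ≤ q then 0 else -1)
      have hsub : dep (j + 1) b p q ⊆ insert R ((dep j b (p - s * 2 ^ j) (q - t * 2 ^ j) ∪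
          dep j b (-s * (2 ^ j - 1)) (-t * (2 ^ j - 1))).image (sh (s * 2 ^ j) (t * 2 ^ j))) := by
        rintro ⟨x, y⟩ he
        rw [mem_dep] at he
        obtain ⟨hG, hW⟩ := he
        simp only at hG hW
        rw [Finset.mem_insert]
        rcases hG with ⟨s', t', hs', ht', hG⟩ | hG
        · right
          rw [W_quad hs' ht' hG] at hW
          obtain rfl := sign_unique hs hs' hsp hW.1
          obtain rfl := sign_unique ht ht' htq hW.2.1
          rw [Finset.mem_image]
          refine ⟨(x - s' * 2 ^ j, y - t' * 2 ^ j), ?_, by simp [sh]⟩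
          rw [Finset.mem_union, mem_dep, mem_dep]
          have h3 := hW.2.2
          simp only [hG, true_and]
          by_contra hcon
          rw [not_or] at hcon
          exact h3 (iff_of_false hcon.1 hcon.2)
        · left
          rw [W_cross hG] at hW
          simp only [R]
          generalize (2 : ℤ) ^ j = a at *
          clear ih
          rcases hs with rfl | rfl <;> rcases ht with rfl | rfl <;>
          cases b <;> simp only [C, X, if_true, Bool.false_eq_true, if_false] at hG hW ⊢ <;>
            split_ifs <;> simp only [Prod.mk.injEq] <;> omega
      have h1 := Finset.card_le_card hsub
      have h2 := h1.trans (Finset.card_insert_le _ _)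
      have h3 := h2.trans (Nat.add_le_add_right (Finset.card_image_le.trans
        (Finset.card_union_le _ _)) 1)
      have h4 := ih b (p - s * 2 ^ j) (q - t * 2 ^ j)
      have h5 := ih b (-s * (2 ^ j - 1)) (-t * (2 ^ j - 1))
      have h6 : ((dep (j + 1) b p q).card : ℤ) ≤ (dep j b (p - s * 2 ^ j) (q - t * 2 ^ j)).card +
          (dep j b (-s * (2 ^ j - 1)) (-t * (2 ^ j - 1))).card + 1 := by exact_mod_cast h3
      rw [pow_succ]; linarith

open scoped Classical in
/-- the outer side of an edge as a finite set -/
noncomputable def side (j : ℕ) (b : Bool) (e : ℤ × ℤ) : Finset (ℤ × ℤ) :=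
  (sq j).filter (fun p => W j b e.1 e.2 p.1 p.2)

open scoped Classical in
/-- edges whose outer side is large or meets `E` -/
noncomputable def bad (K : ℕ) (j : ℕ) (b : Bool) (E : Finset (ℤ × ℤ)) : Finset (ℤ × ℤ) :=
  (sq j).filter (fun e => G j b e.1 e.2 ∧
    (K < (side j b e).card ∨ ∃ p ∈ E, W j b e.1 e.2 p.1 p.2))

lemma mem_bad {K j : ℕ} {b : Bool} {E : Finset (ℤ × ℤ)} {e : ℤ × ℤ} :
    e ∈ bad K j b E ↔ G j b e.1 e.2 ∧
    (K < (side j b e).card ∨ ∃ p ∈ E, W j b e.1 e.2 p.1 p.2) := by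
  classical
  simp only [bad, Finset.mem_filter, and_iff_right_iff_imp]
  intro h
  exact (G_mem_sq h.1).1

lemma bad_base (K j : ℕ) (b : Bool) (E : Finset (ℤ × ℤ)) (hK : (sq j).card ≤ K) :
    ((bad K j b E).card : ℤ) ≤ (2 ^ j - 1) * E.card := by
  classical
  have hsub : bad K j b E ⊆ E.biUnion (fun p => dep j b p.1 p.2) := by
    intro e he
    rw [mem_bad] at he
    obtain ⟨hG, h | ⟨p, hp, h⟩⟩ := he
    · have : (side j b e).card ≤ (sq j).card := Finset.card_le_card (Finset.filter_subset _ _)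
      omega
    · rw [Finset.mem_biUnion]
      exact ⟨p, hp, mem_dep.2 ⟨hG, h⟩⟩
  have h1 : ((bad K j b E).card : ℤ) ≤ ∑ p ∈ E, ((dep j b p.1 p.2).card : ℤ) := by
    exact_mod_cast (Finset.card_le_card hsub).trans Finset.card_biUnion_le
  refine h1.trans ((Finset.sum_le_card_nsmul _ _ (2 ^ j - 1) (fun p _ => dep_card j b p.1 p.2)).trans ?_)
  rw [nsmul_eq_mul, mul_comm]

open scoped Classical in
/-- exceptional vertices of a quadrant, in local coordinates -/
noncomputable def EQ (j : ℕ) (E : Finset (ℤ × ℤ)) (s t : ℤ) : Finset (ℤ × ℤ) :=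
  insert (-s * (2 ^ j - 1), -t * (2 ^ j - 1))
    ((E.filter (fun p => 1 ≤ s * p.1 ∧ 1 ≤ t * p.2)).image (sh (-(s * 2 ^ j)) (-(t * 2 ^ j))))

lemma EQ_card (j : ℕ) (E : Finset (ℤ × ℤ)) :
    (EQ j E 1 1).card + (EQ j E 1 (-1)).card + (EQ j E (-1) 1).card + (EQ j E (-1) (-1)).card
      ≤ E.card + 4 := by
  classical
  have h : ∀ s t, (EQ j E s t).card ≤ (E.filter (fun p => 1 ≤ s * p.1 ∧ 1 ≤ t * p.2)).card + 1 := by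
    intro s t
    unfold EQ
    refine (Finset.card_insert_le _ _).trans (Nat.add_le_add_right ?_ 1)
    convert Finset.card_image_le
  have h11 := h 1 1
  have h12 := h 1 (-1)
  have h21 := h (-1) 1
  have h22 := h (-1) (-1)
  have key : (E.filter (fun p => 1 ≤ 1 * p.1 ∧ 1 ≤ 1 * p.2)).card +
      (E.filter (fun p => 1 ≤ 1 * p.1 ∧ 1 ≤ (-1) * p.2)).card +
      (E.filter (fun p => 1 ≤ (-1) * p.1 ∧ 1 ≤ 1 * p.2)).card +
      (E.filter (fun p => 1 ≤ (-1) * p.1 ∧ 1 ≤ (-1) * p.2)).card ≤ E.card := by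
    simp only [Finset.card_filter]
    rw [← Finset.sum_add_distrib, ← Finset.sum_add_distrib, ← Finset.sum_add_distrib,
      Finset.card_eq_sum_ones]
    apply Finset.sum_le_sum
    intro p _
    split_ifs <;> omega
  omega

/-- all cross edges of direction `b` -/
noncomputable def crossSet (a : ℤ) (b : Bool) : Finset (ℤ × ℤ) :=
  if b then Finset.Icc (-(2 * a - 1)) (2 * a - 2) ×ˢ {0}
  else ({0} ×ˢ Finset.Icc (-(2 * a - 1)) (2 * a - 2)) ∪ {(1, 0), (1, -1), (-1, 0), (-1, -1)}

lemma crossSet_card (a : ℤ) (ha : 1 ≤ a) (b : Bool) : ((crossSet a b).card : ℤ) ≤ 4 * a + 2 := by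
  have hI : ((Finset.Icc (-(2 * a - 1)) (2 * a - 2)).card : ℤ) = 4 * a - 2 := by
    rw [Int.card_Icc, Int.toNat_of_nonneg (by linarith)]; ring
  cases b
  · simp only [crossSet, Bool.false_eq_true, if_false]
    have h1 := Finset.card_union_le (({0} : Finset ℤ) ×ˢ Finset.Icc (-(2 * a - 1)) (2 * a - 2))
      {(1, 0), (1, -1), (-1, 0), (-1, -1)}
    have h2 : ({(1, 0), (1, -1), (-1, 0), (-1, -1)} : Finset (ℤ × ℤ)).card = 4 := by decide
    rw [h2, Finset.card_product, Finset.card_singleton, one_mul] at h1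
    zify at h1
    linarith
  · simp only [crossSet, if_true, Finset.card_product, Finset.card_singleton, mul_one]
    linarith

lemma bad_quad {K j : ℕ} {b : Bool} {E : Finset (ℤ × ℤ)} {x y s t : ℤ}
    (hs : s = 1 ∨ s = -1) (ht : t = 1 ∨ t = -1)
    (hG : G j b (x - s * 2 ^ j) (y - t * 2 ^ j)) (h : (x, y) ∈ bad K (j + 1) b E) :
    (x, y) ∈ (bad K j b (EQ j E s t)).image (sh (s * 2 ^ j) (t * 2 ^ j)) := by
  classical
  rw [Finset.mem_image]
  refine ⟨(x - s * 2 ^ j, y - t * 2 ^ j), ?_, by simp [sh]⟩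
  rw [mem_bad]
  refine ⟨hG, ?_⟩
  by_cases hc : W j b (x - s * 2 ^ j) (y - t * 2 ^ j) (-s * (2 ^ j - 1)) (-t * (2 ^ j - 1))
  · exact Or.inr ⟨_, Finset.mem_insert_self _ _, hc⟩
  · rw [mem_bad] at h
    have hW : ∀ p q, W (j + 1) b x y p q ↔ 1 ≤ s * p ∧ 1 ≤ t * q ∧
        W j b (x - s * 2 ^ j) (y - t * 2 ^ j) (p - s * 2 ^ j) (q - t * 2 ^ j) := by
      intro p q
      rw [W_quad hs ht hG]
      simp only [hc, iff_false, not_not]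
    rcases h.2 with h | ⟨p, hp, h⟩
    · left
      refine lt_of_lt_of_le h ?_
      have : side (j + 1) b (x, y) ⊆
          (side j b (x - s * 2 ^ j, y - t * 2 ^ j)).image (sh (s * 2 ^ j) (t * 2 ^ j)) := by
        rintro ⟨p, q⟩ hp
        simp only [side, Finset.mem_filter, mem_sq, hW] at hp
        rw [Finset.mem_image]
        refine ⟨(p - s * 2 ^ j, q - t * 2 ^ j), ?_, by simp [sh]⟩
        simp only [side, Finset.mem_filter, mem_sq]
        refine ⟨?_, hp.2.2.2⟩
        obtain ⟨h1, h2, h3, _⟩ := hp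
        clear hW hc hG h
        rw [pow_succ] at h1
        generalize (2 : ℤ) ^ j = a at *
        rcases hs with rfl | rfl <;> rcases ht with rfl | rfl <;> omega
      exact (Finset.card_le_card this).trans Finset.card_image_le
    · right
      have h' := (hW _ _).1 h
      refine ⟨(p.1 - s * 2 ^ j, p.2 - t * 2 ^ j), ?_, h'.2.2⟩
      apply Finset.mem_insert_of_mem
      rw [Finset.mem_image]
      exact ⟨p, Finset.mem_filter.2 ⟨hp, h'.1, h'.2.1⟩, by simp [sh, sub_eq_add_neg]⟩

lemma bad_step (K j : ℕ) (b : Bool) (E : Finset (ℤ × ℤ)) :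
    (bad K (j + 1) b E).card ≤ (bad K j b (EQ j E 1 1)).card + (bad K j b (EQ j E 1 (-1))).card +
      (bad K j b (EQ j E (-1) 1)).card + (bad K j b (EQ j E (-1) (-1))).card +
      (crossSet (2 ^ j) b).card := by
  classical
  let Im (s t : ℤ) := (bad K j b (EQ j E s t)).image (sh (s * 2 ^ j) (t * 2 ^ j))
  have hsub : bad K (j + 1) b E ⊆
      Im 1 1 ∪ Im 1 (-1) ∪ Im (-1) 1 ∪ Im (-1) (-1) ∪ crossSet (2 ^ j) b := by
    rintro ⟨x, y⟩ he
    have he' := (mem_bad.1 he).1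
    simp only [Finset.mem_union]
    rcases he' with ⟨s, t, hs, ht, hG⟩ | hC
    · left
      have := bad_quad hs ht hG he
      rcases hs with rfl | rfl <;> rcases ht with rfl | rfl
      · exact Or.inl (Or.inl (Or.inl this))
      · exact Or.inl (Or.inl (Or.inr this))
      · exact Or.inl (Or.inr this)
      · exact Or.inr this
    · right
      generalize (2 : ℤ) ^ j = a at *
      cases b <;> simp only [C, crossSet, if_true, Bool.false_eq_true, if_false, Finset.mem_union,
        Finset.mem_product, Finset.mem_singleton, Finset.mem_Icc, Finset.mem_insert,
        Prod.mk.injEq] at hC ⊢ <;> omega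
  have hIm : ∀ s t, (Im s t).card ≤ (bad K j b (EQ j E s t)).card :=
    fun s t => Finset.card_image_le
  have h0 := Finset.card_le_card hsub
  have h1 := Finset.card_union_le (Im 1 1 ∪ Im 1 (-1) ∪ Im (-1) 1 ∪ Im (-1) (-1)) (crossSet (2 ^ j) b)
  have h2 := Finset.card_union_le (Im 1 1 ∪ Im 1 (-1) ∪ Im (-1) 1) (Im (-1) (-1))
  have h3 := Finset.card_union_le (Im 1 1 ∪ Im 1 (-1)) (Im (-1) 1)
  have h4 := Finset.card_union_le (Im 1 1) (Im 1 (-1))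
  have := hIm 1 1
  have := hIm 1 (-1)
  have := hIm (-1) 1
  have := hIm (-1) (-1)
  omega

lemma bad_bound (K j : ℕ) (b : Bool) (hK : (sq j).card ≤ K) (i : ℕ) : ∀ E : Finset (ℤ × ℤ),
    3 * ((bad K (j + i) b E).card : ℤ) ≤ (10 * 2 ^ j - 2) * 4 ^ i - 6 * 2 ^ j * 2 ^ i - 4 * 2 ^ j + 2
      + 3 * (2 ^ j - 1) * E.card := by
  induction i with
  | zero =>
    intro E
    have := bad_base K j b E hK
    simp only [add_zero, pow_zero]
    linarith
  | succ i ih =>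
    intro E
    have ha : (1 : ℤ) ≤ 2 ^ j := one_le_pow₀ (by norm_num)
    have hb : (1 : ℤ) ≤ 2 ^ (j + i) := one_le_pow₀ (by norm_num)
    have h0 := bad_step K (j + i) b E
    have h1 := EQ_card (j + i) E
    have h2 := crossSet_card (2 ^ (j + i)) hb b
    zify at h0 h1
    have e1 := ih (EQ (j + i) E 1 1)
    have e2 := ih (EQ (j + i) E 1 (-1))
    have e3 := ih (EQ (j + i) E (-1) 1)
    have e4 := ih (EQ (j + i) E (-1) (-1))
    have h3 := mul_le_mul_of_nonneg_left h1 (show (0 : ℤ) ≤ 3 * (2 ^ j - 1) by linarith)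
    rw [← add_assoc]
    have h4 : (2 : ℤ) ^ (j + i) = 2 ^ j * 2 ^ i := pow_add _ _ _
    rw [pow_succ 4, pow_succ 2 i]
    generalize (crossSet (2 ^ (j + i)) b).card = cc at *
    rw [h4] at h2
    linarith

lemma half_sum (V : Finset (ℤ × ℤ)) (f : ℤ × ℤ → ℤ) (c d : ℤ) :
    ∑ p ∈ V, (f p - f (sh (-c) (-d) p)) = ∑ p ∈ V ∪ V.image (sh (-c) (-d)),
      ((if p ∈ V then f p else 0) - (if sh c d p ∈ V then f p else 0)) := by
  classical
  have hinj : Function.Injective (sh (-c) (-d)) := by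
    rintro ⟨a, b⟩ ⟨a', b'⟩ h
    simpa [sh] using h
  have hsh : ∀ p, sh c d p ∈ V ↔ p ∈ V.image (sh (-c) (-d)) := by
    intro p
    rw [Finset.mem_image]
    constructor
    · intro h; exact ⟨_, h, by simp [sh]⟩
    · rintro ⟨q, hq, rfl⟩; simpa [sh] using hq
  rw [Finset.sum_sub_distrib, Finset.sum_sub_distrib]
  congr 1
  · rw [Finset.sum_ite_mem, Finset.inter_eq_right.2 Finset.subset_union_left]
  · simp only [hsh]
    rw [Finset.sum_ite_mem, Finset.inter_eq_right.2 Finset.subset_union_right,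
      Finset.sum_image (fun _ _ _ _ h => hinj h)]

lemma flux (j : ℕ) (w : ℤ × ℤ → Bool → ℤ) (hw : ∀ p b, ¬ G j b p.1 p.2 → w p b = 0)
    (V : Finset (ℤ × ℤ)) (b : Bool) (e : ℤ × ℤ) (hG : G j b e.1 e.2)
    (hcut : ∀ b' p, G j b' p.1 p.2 → ((p ∈ V ↔ sh (dx b') (dy b') p ∈ V) ↔ ¬ (b' = b ∧ p = e))) :
    |w e b| = |∑ p ∈ V, divB w p| := by
  classical
  let F (b' : Bool) : ℤ := ∑ p ∈ V, (w p b' - w (sh (-dx b') (-dy b') p) b')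
  have hdiv : ∑ p ∈ V, divB w p = F true + F false := by
    simp only [F]
    rw [← Finset.sum_add_distrib]
    apply Finset.sum_congr rfl
    intro p _
    simp only [divB, sh, dx, dy, if_true, Bool.false_eq_true, if_false, neg_zero, add_zero]
    simp only [← sub_eq_add_neg]
    ring
  have hF : ∀ b', F b' = ∑ p ∈ V ∪ V.image (sh (-dx b') (-dy b')),
      ((if p ∈ V then w p b' else 0) - (if sh (dx b') (dy b') p ∈ V then w p b' else 0)) :=
    fun b' => half_sum V (fun p => w p b') _ _
  have hzero : ∀ b' p, ¬ (b' = b ∧ p = e) →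
      ((if p ∈ V then w p b' else 0) - (if sh (dx b') (dy b') p ∈ V then w p b' else 0)) = 0 := by
    intro b' p h
    by_cases hg : G j b' p.1 p.2
    · have := (hcut b' p hg).2 h
      simp only [this, sub_self]
    · simp [hw p b' hg]
  have hne : ∀ b', b' ≠ b → F b' = 0 := by
    intro b' hb
    rw [hF]
    exact Finset.sum_eq_zero (fun p _ => hzero b' p (fun h => hb h.1))
  have hself : |F b| = |w e b| := by
    rw [hF, Finset.sum_eq_single e]
    · have := (hcut b e hG)
      by_cases h1 : e ∈ V <;> by_cases h2 : sh (dx b) (dy b) e ∈ V <;> simp [h1, h2] at this ⊢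
    · intro p _ hp
      exact hzero b p (fun h => hp h.2)
    · intro he
      rw [Finset.mem_union, not_or, Finset.mem_image] at he
      have h2 : sh (dx b) (dy b) e ∉ V := fun h => he.2 ⟨_, h, by simp [sh]⟩
      simp [he.1, h2]
  rw [hdiv, ← hself]
  cases b
  · rw [hne true (by simp), zero_add]
  · rw [hne false (by simp), add_zero]

lemma sum_div_eq (w : ℤ × ℤ → Bool → ℤ) (V : Finset (ℤ × ℤ)) (h : ∀ p ∈ V, divB w p = 1) :
    |∑ p ∈ V, divB w p| = V.card := by
  rw [Finset.sum_congr rfl h]; simp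

lemma mem_side {j : ℕ} {b : Bool} {e p : ℤ × ℤ} :
    p ∈ side j b e ↔ p ∈ sq j ∧ W j b e.1 e.2 p.1 p.2 := by
  classical
  simp [side]

/-- the two possible values of the field on an edge -/
lemma field_bound (j : ℕ) (w : ℤ × ℤ → Bool → ℤ) (hw : ∀ p b, ¬ G j b p.1 p.2 → w p b = 0)
    (r : ℤ × ℤ) (hdiv : ∀ p ∈ sq j, p ≠ r → divB w p = 1)
    (b : Bool) (e : ℤ × ℤ) (hG : G j b e.1 e.2) :
    |w e b| ≤ (sq j).card ∧ (¬ W j b e.1 e.2 r.1 r.2 → |w e b| = (side j b e).card) := by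
  classical
  have hsq : ∀ b' p, G j b' p.1 p.2 → p ∈ sq j ∧ sh (dx b') (dy b') p ∈ sq j :=
    fun b' p h => G_mem_sq h
  have hc : ∀ b' p, G j b' p.1 p.2 →
      ((p ∈ side j b e ↔ sh (dx b') (dy b') p ∈ side j b e) ↔ ¬ (b' = b ∧ p = e)) := by
    intro b' p h
    have := cut j b e.1 e.2 hG b' p.1 p.2 h
    simp only [mem_side, hsq b' p h, true_and]
    rw [Prod.ext_iff]
    exact this
  have h1 := flux j w hw (side j b e) b e hG hc
  have h2 := flux j w hw (sq j \ side j b e) b e hG (by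
    intro b' p h
    rw [← hc b' p h]
    simp only [Finset.mem_sdiff, hsq b' p h, true_and]
    exact not_iff_not)
  have hn : r ∉ side j b e → |w e b| = (side j b e).card := by
    intro hr
    rw [h1]
    apply sum_div_eq
    intro p hp
    exact hdiv p (mem_side.1 hp).1 (fun h => hr (h ▸ hp))
  refine ⟨?_, fun h => hn (fun h' => h (mem_side.1 h').2)⟩
  by_cases hr : r ∈ side j b e
  · rw [h2, sum_div_eq]
    · exact_mod_cast Finset.card_le_card Finset.sdiff_subset
    · intro p hp
      rw [Finset.mem_sdiff] at hp
      exact hdiv p hp.1 (fun h => hp.2 (h ▸ hr))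
  · rw [hn hr]
    exact_mod_cast Finset.card_le_card (Finset.filter_subset _ _)

/-- the set of edges with large field value, centred coordinates -/
noncomputable def large (j : ℕ) (w : ℤ × ℤ → Bool → ℤ) (k : ℕ) (b : Bool) : Finset (ℤ × ℤ) :=
  (sq j).filter (fun e => (2 : ℤ) ^ (2 * k) < |w e b|)

lemma large_bound (j : ℕ) (w : ℤ × ℤ → Bool → ℤ) (hw : ∀ p b, ¬ G j b p.1 p.2 → w p b = 0)
    (r : ℤ × ℤ) (hdiv : ∀ p ∈ sq j, p ≠ r → divB w p = 1) (k : ℕ) (hk : 1 ≤ k) (b : Bool) :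
    ((large j w k b).card : ℤ) * 2 ^ k ≤ 2 * (2 * 2 ^ j - 1) ^ 2 := by
  classical
  have hGl : ∀ e ∈ large j w k b, G j b e.1 e.2 := by
    intro e he
    by_contra h
    have h1 := (Finset.mem_filter.1 he).2
    rw [hw e b h, abs_zero] at h1
    have : (0 : ℤ) < 2 ^ (2 * k) := by positivity
    linarith
  obtain ⟨k, rfl⟩ : ∃ l, k = l + 1 := ⟨k - 1, by omega⟩
  have hsqK : ∀ l, l ≤ k → ((sq l).card : ℤ) ≤ 2 ^ (2 * (k + 1)) := by
    intro l hl
    rw [card_sq]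
    have ha : (1 : ℤ) ≤ 2 ^ l := one_le_pow₀ (by norm_num)
    have hb : (2 : ℤ) ^ l ≤ 2 ^ k := pow_le_pow_right₀ (by norm_num) hl
    have : (2 : ℤ) ^ (2 * (k + 1)) = (2 * 2 ^ k) ^ 2 := by ring
    rw [this]
    apply pow_le_pow_left₀ <;> linarith
  rcases le_or_gt j k with hj | hj
  · have : large j w (k + 1) b = ∅ := by
      rw [Finset.eq_empty_iff_forall_notMem]
      intro e he
      have h1 := (Finset.mem_filter.1 he).2
      have h2 := (field_bound j w hw r hdiv b e (hGl e he)).1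
      have h3 := hsqK j hj
      linarith
    rw [this]
    simp only [Finset.card_empty, Nat.cast_zero, zero_mul]
    positivity
  · obtain ⟨i, rfl⟩ : ∃ i, j = k + (i + 1) := ⟨j - k - 1, by omega⟩
    have hsub : large (k + (i + 1)) w (k + 1) b ⊆ bad (2 ^ (2 * (k + 1))) (k + (i + 1)) b {r} := by
      intro e he
      have hG := hGl e he
      rw [mem_bad]
      refine ⟨hG, ?_⟩
      by_cases hr : W (k + (i + 1)) b e.1 e.2 r.1 r.2
      · exact Or.inr ⟨r, by simp, hr⟩
      · left
        have h1 := (Finset.mem_filter.1 he).2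
        have h2 := (field_bound _ w hw r hdiv b e hG).2 hr
        rw [h2] at h1
        exact_mod_cast h1
    have hb := bad_bound (2 ^ (2 * (k + 1))) k b (by exact_mod_cast hsqK k le_rfl) (i + 1) {r}
    have hc : ((large (k + (i + 1)) w (k + 1) b).card : ℤ) ≤
      (bad (2 ^ (2 * (k + 1))) (k + (i + 1)) b {r}).card := by
      exact_mod_cast Finset.card_le_card hsub
    generalize ((large (k + (i + 1)) w (k + 1) b).card : ℤ) = L at *
    generalize ((bad (2 ^ (2 * (k + 1))) (k + (i + 1)) b {r}).card : ℤ) = B at *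
    rw [Finset.card_singleton] at hb
    have e1 : (4 : ℤ) ^ (i + 1) = (2 ^ (i + 1)) ^ 2 := by
      rw [← pow_mul, mul_comm, pow_mul]; norm_num
    rw [e1] at hb
    rw [pow_succ 2 k, pow_add 2 k]
    have ha : (1 : ℤ) ≤ 2 ^ k := one_le_pow₀ (by norm_num)
    have hi : (2 : ℤ) ≤ 2 ^ (i + 1) := by
      have : (1 : ℤ) ≤ 2 ^ i := one_le_pow₀ (by norm_num)
      rw [pow_succ]; linarith
    generalize (2 : ℤ) ^ k = a at *
    generalize (2 : ℤ) ^ (i + 1) = z at *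
    have h3 : 3 * L ≤ (10 * a - 2) * z ^ 2 - 6 * a * z - a - 1 := by push_cast at hb; linarith
    have h4 : 3 * L ≤ 12 * a * z ^ 2 - 12 * z := by
      nlinarith [mul_nonneg (sub_nonneg.2 ha) (sq_nonneg z), mul_nonneg (sub_nonneg.2 hi) (by linarith : (0:ℤ) ≤ z), mul_nonneg (sub_nonneg.2 ha) (by linarith : (0:ℤ) ≤ z)]
    nlinarith

end Frag

namespace Frag

lemma count_bound (u : ℕ → ℤ × ℤ → Bool → ℤ) (r : ℕ → ℤ × ℤ)
    (hsupp : ∀ n, 1 ≤ n → ∀ p b, s(p, ept p b) ∉ fragEdges n → u n p b = 0)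
    (hdiv : ∀ n, 1 ≤ n → ∀ p ∈ fragVerts n, p ≠ r n → divB (u n) p = 1)
    (y : (ℤ × ℤ) × Bool) (k : ℕ) (hk : 1 ≤ k) (n : ℕ) (hn : 1 ≤ n) :
    (Finset.univ.filter (fun S : Fin (2 ^ n - 1) × Fin (2 ^ n - 1) => (2 : ℤ) ^ (2 * k) <
      |shiftF ((S.1 : ℤ), (S.2 : ℤ)) (tiled (2 ^ n - 1) (u n)) y.1 y.2|)).card * 2 ^ k
      ≤ 2 * (2 ^ n - 1) ^ 2 := by
  classical
  obtain ⟨j, rfl⟩ : ∃ j, n = j + 1 := ⟨n - 1, by omega⟩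
  set h : ℤ := 2 ^ j - 1 with hh
  have ha : (1 : ℤ) ≤ 2 ^ j := one_le_pow₀ (by norm_num)
  have hM : (2 : ℤ) ^ (j + 1) - 1 = 2 * h + 1 := by rw [hh]; ring
  have hMN : ((2 ^ (j + 1) - 1 : ℕ) : ℤ) = 2 * h + 1 := by
    rw [Nat.cast_sub Nat.one_le_two_pow]; push_cast; exact hM
  have hh0 : 0 ≤ h := by linarith
  let w : ℤ × ℤ → Bool → ℤ := fun p b => u (j + 1) (p.1 + h, p.2 + h) b
  have hw : ∀ p b, ¬ G j b p.1 p.2 → w p b = 0 := by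
    intro p b hG
    apply hsupp (j + 1) hn
    intro hmem
    exact hG (G_of_frag' j b p.1 p.2 hmem)
  have hd : ∀ p ∈ sq j, p ≠ ((r (j + 1)).1 - h, (r (j + 1)).2 - h) → divB w p = 1 := by
    intro p hp hpr
    rw [mem_sq, ← hh] at hp
    have := hdiv (j + 1) hn (p.1 + h, p.2 + h) (by
      simp only [fragVerts, Set.mem_ofPred_eq]; rw [hM]; omega) (by
      intro heq
      apply hpr
      rw [← heq]; simp)
    rw [← this]
    simp only [divB, w]
    rw [show p.1 - 1 + h = p.1 + h - 1 by ring, show p.2 - 1 + h = p.2 + h - 1 by ring]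
  have hL := large_bound j w hw _ hd k hk y.2
  have hcard : (Finset.univ.filter (fun S : Fin (2 ^ (j + 1) - 1) × Fin (2 ^ (j + 1) - 1) =>
      (2 : ℤ) ^ (2 * k) <
      |shiftF ((S.1 : ℤ), (S.2 : ℤ)) (tiled (2 ^ (j + 1) - 1) (u (j + 1))) y.1 y.2|)).card ≤
      (large j w k y.2).card := by
    apply Finset.card_le_card_of_injOn
      (fun S => ((y.1.1 + (S.1 : ℤ)) % (2 * h + 1) - h, (y.1.2 + (S.2 : ℤ)) % (2 * h + 1) - h))
    · intro S hS
      have hS' := (Finset.mem_filter.1 hS).2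
      simp only [shiftF, tiled] at hS'
      rw [hM] at hS'
      have m1 := Int.emod_nonneg (y.1.1 + (S.1 : ℤ)) (show 2 * h + 1 ≠ 0 by omega)
      have m2 := Int.emod_nonneg (y.1.2 + (S.2 : ℤ)) (show 2 * h + 1 ≠ 0 by omega)
      have m3 := Int.emod_lt_of_pos (y.1.1 + (S.1 : ℤ)) (show 0 < 2 * h + 1 by omega)
      have m4 := Int.emod_lt_of_pos (y.1.2 + (S.2 : ℤ)) (show 0 < 2 * h + 1 by omega)
      refine Finset.mem_coe.2 (Finset.mem_filter.2 ⟨?_, ?_⟩)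
      · rw [mem_sq, ← hh]
        dsimp only
        omega
      · simp only [w, sub_add_cancel]
        exact hS'
    · have key : ∀ (c : ℤ) (S T : Fin (2 ^ (j + 1) - 1)),
          (c + (S : ℤ)) % (2 * h + 1) - h = (c + (T : ℤ)) % (2 * h + 1) - h → S = T := by
        intro c S T hST
        have h1 : (c + (S : ℤ)) % (2 * h + 1) = (c + (T : ℤ)) % (2 * h + 1) := by linarith
        have h2 : (S : ℤ) % (2 * h + 1) = (T : ℤ) % (2 * h + 1) :=
          Int.ModEq.add_left_cancel' c h1
        have s1 : ((S : ℕ) : ℤ) < 2 * h + 1 := by rw [← hMN]; exact_mod_cast S.2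
        have s2 : ((T : ℕ) : ℤ) < 2 * h + 1 := by rw [← hMN]; exact_mod_cast T.2
        rw [Int.emod_eq_of_lt (by positivity) s1, Int.emod_eq_of_lt (by positivity) s2] at h2
        exact Fin.ext (by exact_mod_cast h2)
      intro S _ T _ hST
      simp only [Prod.mk.injEq] at hST
      exact Prod.ext (key _ _ _ hST.1) (key _ _ _ hST.2)
  have hfin := Nat.mul_le_mul_right (2 ^ k) hcard
  zify
  zify at hfin
  rw [hMN]
  have : (2 * 2 ^ j - 1 : ℤ) = 2 * h + 1 := by rw [hh]; ring
  rw [this] at hL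
  exact hfin.trans hL

lemma unif_apply (M : ℕ) (P : Fin M × Fin M → Prop) [DecidablePred P] :
    unifShift M {S | P S} = ((M ^ 2 : ℕ) : ENNReal)⁻¹ * ((Finset.univ.filter P).card : ENNReal) := by
  have : {S | P S} = ((Finset.univ.filter P : Finset _) : Set (Fin M × Fin M)) := by ext; simp
  rw [this, unifShift, Measure.smul_apply, Measure.count_apply_finset, smul_eq_mul]
  simp [pow_two]

lemma prob_bound (u : ℕ → ℤ × ℤ → Bool → ℤ) (r : ℕ → ℤ × ℤ)
    (hsupp : ∀ n, 1 ≤ n → ∀ p b, s(p, ept p b) ∉ fragEdges n → u n p b = 0)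
    (hdiv : ∀ n, 1 ≤ n → ∀ p ∈ fragVerts n, p ≠ r n → divB (u n) p = 1)
    (y : (ℤ × ℤ) × Bool) (k : ℕ) (hk : 1 ≤ k) (n : ℕ) (hn : 1 ≤ n) :
    unifShift (2 ^ n - 1)
              {S | (2 : ℤ) ^ (2 * k) <
                |shiftF ((S.1 : ℤ), (S.2 : ℤ)) (tiled (2 ^ n - 1) (u n)) y.1 y.2|}
      ≤ 2 / 2 ^ k := by
  have h := count_bound u r hsupp hdiv y k hk n hn
  rw [unif_apply]
  generalize Finset.card _ = N at *
  have hM : 0 < 2 ^ n - 1 := by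
    have : 2 ^ 1 ≤ 2 ^ n := Nat.pow_le_pow_right (by norm_num) hn
    omega
  generalize 2 ^ n - 1 = M at *
  have h' : (N : ENNReal) * 2 ^ k ≤ 2 * ((M ^ 2 : ℕ) : ENNReal) := by exact_mod_cast h
  have hM2 : ((M ^ 2 : ℕ) : ENNReal) ≠ 0 := by
    have : M ^ 2 ≠ 0 := by positivity
    exact_mod_cast this
  rw [mul_comm, ← div_eq_mul_inv]
  rw [ENNReal.div_le_iff hM2 (ENNReal.natCast_ne_top _), ENNReal.mul_comm_div]
  rw [← mul_div_assoc, ENNReal.le_div_iff_mul_le (Or.inl (by simp)) (Or.inl (by simp))]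
  exact h'

lemma unif_le_one (M : ℕ) (hM : 0 < M) (s : Set (Fin M × Fin M)) : unifShift M s ≤ 1 := by
  classical
  have : unifShift M {S | S ∈ s} ≤ 1 := by
    rw [unif_apply, mul_comm, ← div_eq_mul_inv]
    apply ENNReal.div_le_of_le_mul
    rw [one_mul]
    have := Finset.card_filter_le (Finset.univ : Finset (Fin M × Fin M)) (fun S => S ∈ s)
    rw [Finset.card_univ, Fintype.card_prod, Fintype.card_fin, ← pow_two] at this
    exact_mod_cast this
  exact this

end Frag

/-- Let `v_n` (for `n ≥ 1`) be the uniformly random shift of the periodic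
tiling of `ℤ²` by the `n`-th fragment's vector field `u n` (supported on the
fragment's edges, divergence `+1` at every fragment vertex except the root
`r n`).  Then for every edge `y` of `ℤ²` and every `k ≥ 1`,
`sup_n ℙ(|(v_n)_y| > 2^{2k}) ≤ 2·2^{−k}`; consequently
`sup_n ℙ(|(v_n)_y| > C) = O(1/√C)` as `C → ∞`. -/
theorem sup_tail_bound
    (u : ℕ → ℤ × ℤ → Bool → ℤ) (r : ℕ → ℤ × ℤ)
    (hr : ∀ n, 1 ≤ n → r n ∈ fragVerts n)
    (hsupp : ∀ n, 1 ≤ n → ∀ p b, s(p, ept p b) ∉ fragEdges n → u n p b = 0)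
    (hdiv : ∀ n, 1 ≤ n → ∀ p ∈ fragVerts n, p ≠ r n → divB (u n) p = 1) :
    ∀ y : (ℤ × ℤ) × Bool,
      (∀ k : ℕ, 1 ≤ k →
        (⨆ n, ⨆ (_ : 1 ≤ n),
            unifShift (2 ^ n - 1)
              {S | (2 : ℤ) ^ (2 * k) <
                |shiftF ((S.1 : ℤ), (S.2 : ℤ)) (tiled (2 ^ n - 1) (u n)) y.1 y.2|})
          ≤ 2 / 2 ^ k) ∧
      (∃ c : ℝ, 0 ≤ c ∧ ∀ C : ℝ, 1 ≤ C → ∀ n, 1 ≤ n →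
        (unifShift (2 ^ n - 1)
            {S | C <
              (|shiftF ((S.1 : ℤ), (S.2 : ℤ)) (tiled (2 ^ n - 1) (u n)) y.1 y.2| : ℤ)}).toReal
          ≤ c / Real.sqrt C) := by
  intro y
  constructor
  · intro k hk
    exact iSup_le fun n => iSup_le fun hn => Frag.prob_bound u r hsupp hdiv y k hk n hn
  · refine ⟨4, by norm_num, ?_⟩
    intro C hC n hn
    have hM : 0 < 2 ^ n - 1 := by
      have : 2 ^ 1 ≤ 2 ^ n := Nat.pow_le_pow_right (by norm_num) hn
      omega
    have hC0 : 0 < Real.sqrt C := Real.sqrt_pos.2 (by linarith)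
    obtain ⟨k, hk1, hk2⟩ := exists_nat_pow_near hC (show (1 : ℝ) < 4 by norm_num)
    have hsq : Real.sqrt C ≤ 2 * 2 ^ k := by
      apply Real.sqrt_le_iff.2
      refine ⟨by positivity, ?_⟩
      have : ((2 : ℝ) * 2 ^ k) ^ 2 = 4 ^ (k + 1) := by
        rw [← pow_succ', ← pow_mul, mul_comm, pow_mul]; norm_num
      linarith
    rcases Nat.eq_zero_or_pos k with rfl | hk
    · have h1 := ENNReal.toReal_mono ENNReal.one_ne_top (Frag.unif_le_one (2 ^ n - 1) hM
        {S | C < (|shiftF ((S.1 : ℤ), (S.2 : ℤ)) (tiled (2 ^ n - 1) (u n)) y.1 y.2| : ℤ)})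
      refine h1.trans ?_
      rw [ENNReal.toReal_one, le_div_iff₀ hC0]
      norm_num at hsq
      linarith
    · have h1 := Frag.prob_bound u r hsupp hdiv y k hk n hn
      have h2 := (measure_mono (μ := unifShift (2 ^ n - 1)) (show
        {S : Fin (2 ^ n - 1) × Fin (2 ^ n - 1) |
          C < (|shiftF ((S.1 : ℤ), (S.2 : ℤ)) (tiled (2 ^ n - 1) (u n)) y.1 y.2| : ℤ)} ⊆
        {S | (2 : ℤ) ^ (2 * k) <
                |shiftF ((S.1 : ℤ), (S.2 : ℤ)) (tiled (2 ^ n - 1) (u n)) y.1 y.2|} from by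
          intro S hS
          rw [Set.mem_ofPred_eq] at hS ⊢
          have h3 := lt_of_le_of_lt hk1 hS
          rw [pow_mul]
          norm_num
          exact_mod_cast h3)).trans h1
      have hfin : (2 / 2 ^ k : ENNReal) ≠ ⊤ := ENNReal.div_ne_top (by simp) (by simp)
      refine (ENNReal.toReal_mono hfin h2).trans ?_
      rw [ENNReal.toReal_div, ENNReal.toReal_pow]
      simp only [ENNReal.toReal_ofNat]
      rw [div_le_div_iff₀ (by positivity) hC0]
      linarith
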